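/- Let X be a finite set, let 𝒞 be a finite family of subsets of X such that every element of X belongs to at least one member of 𝒞, and let ℓ ≥ 1 be an integer. For x ∈ X let deg(x) denote the number of sets in 𝒞 containing x. Construct a graph G as follows. Its vertices are s, t, a vertex v_x for each x ∈ X, a vertex w_C for each C ∈ 𝒞, a vertex v_{x,C} for each pair with x ∈ C ∈ 𝒞, a vertex t_x for each x ∈ X, together with the internal vertices of the chains below, where an m-chain between two vertices a and b is a path of length m between a and b whose m−1 internal vertices are new and have degree 2 in G. The edges of G are: for each pair x ∈ C ∈ 𝒞, an (ℓ+1)-chain between v_{x,C} and v_x, an (ℓ+1)-chain between v_{x,C} and t_x, and an (ℓ+1)-chain between v_{x,C} and w_C; for each C ∈ 𝒞, an (ℓ+1)-chain between s and w_C and the single edge {w_C, t}; for each x ∈ X, deg(x) internally disjoint (ℓ+1)-chains between s and v_x; and for each x ∈ X, deg(x)−1 internally disjoint (ℓ+1)-chains between t_x and t. Let p = |𝒞| + Σ_{x∈X} deg(x). Then there exist sets C_1, …, C_{ℓ'} ∈ 𝒞 with ℓ' ≤ ℓ and X = C_1 ∪ … ∪ C_{ℓ'} if and only if G admits a (p,s,t)-routing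 with at most ℓ shared edges. -/

import Mathlib

/-- The set of edges shared by at least two paths of the routing `P`. -/
def mseSharedEdges {V : Type*} {G : SimpleGraph V} {s t : V} {p : ℕ}
    (P : Fin p → G.Walk s t) : Set (Sym2 V) :=
  {e | ∃ i j : Fin p, i ≠ j ∧ e ∈ (P i).edges ∧ e ∈ (P j).edges}

/-- Base relation describing the edges of an `(m+1)`-chain between `a` and `b`
whose `m` internal vertices are `f 0, …, f (m-1)` (in this order):
the edges are `{a, f 0}`, `{f i, f (i+1)}` and `{f (m-1), b}`. -/
def mseChainRel {W : Type*} {m : ℕ} (a b : W) (f : Fin m → W) (x y : W) : Prop :=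
  (∃ i : Fin m, (i : ℕ) = 0 ∧ x = a ∧ y = f i) ∨
  (∃ i j : Fin m, (j : ℕ) = (i : ℕ) + 1 ∧ x = f i ∧ y = f j) ∨
  (∃ i : Fin m, (i : ℕ) = m - 1 ∧ x = f i ∧ y = b)

/-- The vertices of the graph built from a set-cover instance:
`src`/`snk` are `s` and `t`; `vx x` is the vertex `v_x` for `x ∈ X`;
`wC c` is the vertex `w_C` for `C ∈ 𝒞`; `vxc x c h` is the vertex `v_{x,C}` for `x ∈ C`;
`tx x` is the vertex `t_x`; the remaining constructors are the internal vertices of the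
`(ℓ+1)`-chains (with `ℓ` internal vertices each) of the construction, where `d x` is the
number of sets containing `x`. -/
inductive MseSCV (X C : Type) (mem : X → C → Prop) (ℓ : ℕ) (d : X → ℕ) : Type where
  | src : MseSCV X C mem ℓ d
  | snk : MseSCV X C mem ℓ d
  | vx (x : X) : MseSCV X C mem ℓ d
  | wC (c : C) : MseSCV X C mem ℓ d
  | vxc (x : X) (c : C) (h : mem x c) : MseSCV X C mem ℓ d
  | tx (x : X) : MseSCV X C mem ℓ d
  | iVx (x : X) (c : C) (h : mem x c) (i : Fin ℓ) : MseSCV X C mem ℓ d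
  | iTx (x : X) (c : C) (h : mem x c) (i : Fin ℓ) : MseSCV X C mem ℓ d
  | iWc (x : X) (c : C) (h : mem x c) (i : Fin ℓ) : MseSCV X C mem ℓ d
  | iSWc (c : C) (i : Fin ℓ) : MseSCV X C mem ℓ d
  | iSVx (x : X) (c : C) (h : mem x c) (i : Fin ℓ) : MseSCV X C mem ℓ d
  | iTxT (x : X) (j : Fin (d x - 1)) (i : Fin ℓ) : MseSCV X C mem ℓ d

/-- The graph of the reduction from Set Cover: for each pair `x ∈ C ∈ 𝒞`, an `(ℓ+1)`-chain
from `v_{x,C}` to each of `v_x`, `t_x` and `w_C`; for each `C ∈ 𝒞`, an `(ℓ+1)`-chain from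
`s` to `w_C` and the single edge `{w_C, t}`; for each `x`, `d x` internally disjoint
`(ℓ+1)`-chains from `s` to `v_x` (indexed by the sets containing `x`), and `d x - 1`
internally disjoint `(ℓ+1)`-chains from `t_x` to `t`. -/
def mseSCGraph (X C : Type) (mem : X → C → Prop) (ℓ : ℕ) (d : X → ℕ) :
    SimpleGraph (MseSCV X C mem ℓ d) :=
  SimpleGraph.fromRel (fun x y =>
    (∃ (a : X) (c : C) (h : mem a c),
      mseChainRel (MseSCV.vxc a c h) (MseSCV.vx a) (MseSCV.iVx a c h) x y) ∨
    (∃ (a : X) (c : C) (h : mem a c),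
      mseChainRel (MseSCV.vxc a c h) (MseSCV.tx a) (MseSCV.iTx a c h) x y) ∨
    (∃ (a : X) (c : C) (h : mem a c),
      mseChainRel (MseSCV.vxc a c h) (MseSCV.wC c) (MseSCV.iWc a c h) x y) ∨
    (∃ c : C, mseChainRel MseSCV.src (MseSCV.wC c) (MseSCV.iSWc c) x y) ∨
    (∃ c : C, x = MseSCV.wC c ∧ y = MseSCV.snk) ∨
    (∃ (a : X) (c : C) (h : mem a c),
      mseChainRel MseSCV.src (MseSCV.vx a) (MseSCV.iSVx a c h) x y) ∨
    (∃ (a : X) (j : Fin (d a - 1)),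
      mseChainRel (MseSCV.tx a) MseSCV.snk (MseSCV.iTxT a j) x y))

section MseAux

variable {X C : Type} {mem : X → C → Prop} {ℓ : ℕ} {d : X → ℕ}

/-- Indices of the long chains. -/
inductive MseCh (X C : Type) (mem : X → C → Prop) (d : X → ℕ) : Type where
  | cV (x : X) (c : C) (h : mem x c) : MseCh X C mem d
  | cT (x : X) (c : C) (h : mem x c) : MseCh X C mem d
  | cW (x : X) (c : C) (h : mem x c) : MseCh X C mem d
  | cSW (c : C) : MseCh X C mem d
  | cSV (x : X) (c : C) (h : mem x c) : MseCh X C mem d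
  | cTT (x : X) (j : Fin (d x - 1)) : MseCh X C mem d

/-- First end of a chain. -/
def mseA (ℓ : ℕ) : MseCh X C mem d → MseSCV X C mem ℓ d
  | .cV x c h => .vxc x c h
  | .cT x c h => .vxc x c h
  | .cW x c h => .vxc x c h
  | .cSW _ => .src
  | .cSV _ _ _ => .src
  | .cTT x _ => .tx x

/-- Last end of a chain. -/
def mseB (ℓ : ℕ) : MseCh X C mem d → MseSCV X C mem ℓ d
  | .cV x _ _ => .vx x
  | .cT x _ _ => .tx x
  | .cW _ c _ => .wC c
  | .cSW c => .wC c
  | .cSV x _ _ => .vx x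
  | .cTT _ _ => .snk

/-- Internal vertices of a chain. -/
def mseI {ℓ : ℕ} : MseCh X C mem d → Fin ℓ → MseSCV X C mem ℓ d
  | .cV x c h => .iVx x c h
  | .cT x c h => .iTx x c h
  | .cW x c h => .iWc x c h
  | .cSW c => .iSWc c
  | .cSV x c h => .iSVx x c h
  | .cTT x j => .iTxT x j

/-- The chain and position of an internal vertex. -/
def msePos : MseSCV X C mem ℓ d → Option (MseCh X C mem d × ℕ)
  | .iVx x c h i => some (.cV x c h, i + 1)
  | .iTx x c h i => some (.cT x c h, i + 1)
  | .iWc x c h i => some (.cW x c h, i + 1)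
  | .iSWc c i => some (.cSW c, i + 1)
  | .iSVx x c h i => some (.cSV x c h, i + 1)
  | .iTxT x j i => some (.cTT x j, i + 1)
  | _ => none

/-- The vertices of a chain, in order. -/
def mseG (ℓ : ℕ) (k : MseCh X C mem d) (n : ℕ) : MseSCV X C mem ℓ d :=
  if n = 0 then mseA ℓ k else if h : n - 1 < ℓ then mseI k ⟨n - 1, h⟩ else mseB ℓ k

lemma mseG_zero (k : MseCh X C mem d) : mseG ℓ k 0 = mseA ℓ k := by simp [mseG]

lemma mseG_last (k : MseCh X C mem d) : mseG ℓ k (ℓ + 1) = mseB ℓ k := by simp [mseG]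

lemma mseG_mid (k : MseCh X C mem d) (i : Fin ℓ) : mseG ℓ k (i + 1) = mseI k i := by
  simp [mseG]

lemma msePos_I (k : MseCh X C mem d) (i : Fin ℓ) :
    msePos (mseI k i) = some (k, (i : ℕ) + 1) := by
  cases k <;> rfl

lemma msePos_A (k : MseCh X C mem d) : msePos (mseA ℓ k) = none := by
  cases k <;> rfl

lemma msePos_B (k : MseCh X C mem d) : msePos (mseB ℓ k) = none := by
  cases k <;> rfl

lemma mseA_ne_B (k : MseCh X C mem d) : mseA ℓ k ≠ mseB ℓ k := by
  cases k <;> simp [mseA, mseB]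

lemma msePos_G (k : MseCh X C mem d) (n : ℕ) (h0 : n ≠ 0) (h1 : n ≤ ℓ) :
    msePos (mseG ℓ k n) = some (k, n) := by
  obtain ⟨m, rfl⟩ : ∃ m, n = m + 1 := ⟨n - 1, by omega⟩
  rw [mseG_mid k ⟨m, by omega⟩, msePos_I]

lemma msePos_G' (k k' : MseCh X C mem d) (n m : ℕ) (h1 : n ≤ ℓ + 1)
    (h : msePos (mseG ℓ k n) = some (k', m)) : k' = k ∧ m = n ∧ n ≠ 0 ∧ n ≤ ℓ := by
  rcases Nat.eq_zero_or_pos n with rfl | h0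
  · rw [mseG_zero, msePos_A] at h; cases h
  rcases Nat.lt_or_ge ℓ n with h2 | h2
  · obtain rfl : n = ℓ + 1 := by omega
    rw [mseG_last, msePos_B] at h; cases h
  · rw [msePos_G k n (by omega) h2] at h
    cases h
    exact ⟨rfl, rfl, by omega, h2⟩

lemma mseG_inj (k : MseCh X C mem d) (n m : ℕ) (hn : n ≤ ℓ + 1) (hm : m ≤ ℓ + 1)
    (h : mseG ℓ k n = mseG ℓ k m) : n = m := by
  by_cases h1 : n ≠ 0 ∧ n ≤ ℓ
  · have := msePos_G k n h1.1 h1.2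
    rw [h] at this
    exact (msePos_G' _ _ _ _ hm this).2.1
  by_cases h2 : m ≠ 0 ∧ m ≤ ℓ
  · have := msePos_G k m h2.1 h2.2
    rw [← h] at this
    exact (msePos_G' _ _ _ _ hn this).2.1.symm
  have h3 : n = 0 ∨ n = ℓ + 1 := by omega
  have h4 : m = 0 ∨ m = ℓ + 1 := by omega
  rcases h3 with rfl | rfl <;> rcases h4 with rfl | rfl
  · rfl
  · rw [mseG_zero, mseG_last] at h; exact absurd h (mseA_ne_B k)
  · rw [mseG_zero, mseG_last] at h; exact absurd h.symm (mseA_ne_B k)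
  · rfl

lemma mseChainRel_iff (hℓ : 1 ≤ ℓ) (k : MseCh X C mem d) (x y : MseSCV X C mem ℓ d) :
    mseChainRel (mseA ℓ k) (mseB ℓ k) (mseI k) x y ↔
      ∃ n ≤ ℓ, x = mseG ℓ k n ∧ y = mseG ℓ k (n + 1) := by
  constructor
  · rintro (⟨i, hi, rfl, rfl⟩ | ⟨i, j, hij, rfl, rfl⟩ | ⟨i, hi, rfl, rfl⟩)
    · exact ⟨0, by omega, (mseG_zero k).symm, by rw [← mseG_mid, hi]⟩
    · exact ⟨i + 1, by omega, by rw [mseG_mid], by rw [← mseG_mid, hij]⟩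
    · refine ⟨ℓ, le_rfl, ?_, (mseG_last k).symm⟩
      rw [← mseG_mid, hi]; congr 1; omega
  · rintro ⟨n, hn, rfl, rfl⟩
    rcases Nat.eq_zero_or_pos n with rfl | h0
    · exact Or.inl ⟨⟨0, by omega⟩, rfl, mseG_zero k, mseG_mid k ⟨0, by omega⟩⟩
    obtain ⟨m, rfl⟩ : ∃ m, n = m + 1 := ⟨n - 1, by omega⟩
    rcases Nat.lt_or_ge (m + 1) ℓ with h2 | h2
    · exact Or.inr (Or.inl ⟨⟨m, by omega⟩, ⟨m + 1, by omega⟩, rfl,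
        mseG_mid k ⟨m, by omega⟩, mseG_mid k ⟨m + 1, by omega⟩⟩)
    · obtain rfl : ℓ = m + 1 := by omega
      exact Or.inr (Or.inr ⟨⟨m, by omega⟩, by simp, mseG_mid k ⟨m, by omega⟩, mseG_last k⟩)

lemma mse_adj (hℓ : 1 ≤ ℓ) (x y : MseSCV X C mem ℓ d) :
    (mseSCGraph X C mem ℓ d).Adj x y ↔
      (∃ k, ∃ n ≤ ℓ, s(x, y) = s(mseG ℓ k n, mseG ℓ k (n + 1))) ∨
      (∃ c, s(x, y) = s(.wC c, .snk)) := by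
  have key : ∀ x y : MseSCV X C mem ℓ d, ((∃ (a : X) (c : C) (h : mem a c),
      mseChainRel (MseSCV.vxc a c h) (MseSCV.vx a) (MseSCV.iVx a c h) x y) ∨
    (∃ (a : X) (c : C) (h : mem a c),
      mseChainRel (MseSCV.vxc a c h) (MseSCV.tx a) (MseSCV.iTx a c h) x y) ∨
    (∃ (a : X) (c : C) (h : mem a c),
      mseChainRel (MseSCV.vxc a c h) (MseSCV.wC c) (MseSCV.iWc a c h) x y) ∨
    (∃ c : C, mseChainRel MseSCV.src (MseSCV.wC c) (MseSCV.iSWc c) x y) ∨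
    (∃ c : C, x = MseSCV.wC c ∧ y = MseSCV.snk) ∨
    (∃ (a : X) (c : C) (h : mem a c),
      mseChainRel MseSCV.src (MseSCV.vx a) (MseSCV.iSVx a c h) x y) ∨
    (∃ (a : X) (j : Fin (d a - 1)),
      mseChainRel (MseSCV.tx a) MseSCV.snk (MseSCV.iTxT a j) x y)) ↔
      ((∃ k, ∃ n ≤ ℓ, x = mseG ℓ k n ∧ y = mseG ℓ k (n + 1)) ∨
        (∃ c, x = .wC c ∧ y = .snk)) := by
    intro x y
    simp only [← mseChainRel_iff hℓ]
    constructor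
    · rintro (⟨a, c, h, H⟩ | ⟨a, c, h, H⟩ | ⟨a, c, h, H⟩ | ⟨c, H⟩ | H | ⟨a, c, h, H⟩ | ⟨a, j, H⟩)
      · exact Or.inl ⟨.cV a c h, H⟩
      · exact Or.inl ⟨.cT a c h, H⟩
      · exact Or.inl ⟨.cW a c h, H⟩
      · exact Or.inl ⟨.cSW c, H⟩
      · exact Or.inr H
      · exact Or.inl ⟨.cSV a c h, H⟩
      · exact Or.inl ⟨.cTT a j, H⟩
    · rintro (⟨k, H⟩ | H)
      · cases k with
        | cV a c h => exact Or.inl ⟨a, c, h, H⟩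
        | cT a c h => exact Or.inr (Or.inl ⟨a, c, h, H⟩)
        | cW a c h => exact Or.inr (Or.inr (Or.inl ⟨a, c, h, H⟩))
        | cSW c => exact Or.inr (Or.inr (Or.inr (Or.inl ⟨c, H⟩)))
        | cSV a c h => exact Or.inr (Or.inr (Or.inr (Or.inr (Or.inr (Or.inl ⟨a, c, h, H⟩)))))
        | cTT a j => exact Or.inr (Or.inr (Or.inr (Or.inr (Or.inr (Or.inr ⟨a, j, H⟩)))))
      · exact Or.inr (Or.inr (Or.inr (Or.inr (Or.inl H))))
  unfold mseSCGraph
  rw [SimpleGraph.fromRel_adj, key, key]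
  constructor
  · rintro ⟨-, (⟨k, n, hn, rfl, rfl⟩ | ⟨c, rfl, rfl⟩) | (⟨k, n, hn, rfl, rfl⟩ | ⟨c, rfl, rfl⟩)⟩
    · exact Or.inl ⟨k, n, hn, rfl⟩
    · exact Or.inr ⟨c, rfl⟩
    · exact Or.inl ⟨k, n, hn, Sym2.eq_swap⟩
    · exact Or.inr ⟨c, Sym2.eq_swap⟩
  · rintro (⟨k, n, hn, h⟩ | ⟨c, h⟩)
    · have hne : mseG ℓ k n ≠ mseG ℓ k (n + 1) := fun h => by
        have := mseG_inj k n (n + 1) (by omega) (by omega) h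
        omega
      rcases Sym2.eq_iff.1 h with ⟨rfl, rfl⟩ | ⟨rfl, rfl⟩
      · exact ⟨hne, Or.inl (Or.inl ⟨k, n, hn, rfl, rfl⟩)⟩
      · exact ⟨hne.symm, Or.inr (Or.inl ⟨k, n, hn, rfl, rfl⟩)⟩
    · rcases Sym2.eq_iff.1 h with ⟨rfl, rfl⟩ | ⟨rfl, rfl⟩
      · exact ⟨by simp, Or.inl (Or.inr ⟨c, rfl, rfl⟩)⟩
      · exact ⟨by simp, Or.inr (Or.inr ⟨c, rfl, rfl⟩)⟩

/-- Neighbours of an internal vertex of a chain. -/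
lemma mse_adj_mid (hℓ : 1 ≤ ℓ) (k : MseCh X C mem d) (n : ℕ) (hn : n < ℓ)
    (y : MseSCV X C mem ℓ d) (h : (mseSCGraph X C mem ℓ d).Adj (mseG ℓ k (n + 1)) y) :
    y = mseG ℓ k n ∨ y = mseG ℓ k (n + 2) := by
  have hp := msePos_G (ℓ := ℓ) k (n + 1) (by omega) (by omega)
  rcases (mse_adj hℓ _ _).1 h with ⟨k', m, hm, h⟩ | ⟨c, h⟩
  · rcases Sym2.eq_iff.1 h with ⟨h1, rfl⟩ | ⟨h1, rfl⟩
    · rw [h1] at hp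
      obtain ⟨rfl, rfl, -⟩ := msePos_G' _ _ _ _ (by omega) hp
      exact Or.inr rfl
    · rw [h1] at hp
      obtain ⟨rfl, h3, -⟩ := msePos_G' _ _ _ _ (by omega) hp
      obtain rfl : n = m := by omega
      exact Or.inl rfl
  · rcases Sym2.eq_iff.1 h with ⟨h1, rfl⟩ | ⟨h1, rfl⟩ <;> rw [h1] at hp <;> cases hp

/-- Neighbours of a hub vertex. -/
lemma mse_adj_hub (hℓ : 1 ≤ ℓ) (v y : MseSCV X C mem ℓ d) (hv : msePos v = none)
    (h : (mseSCGraph X C mem ℓ d).Adj v y) :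
    (∃ k, mseA ℓ k = v ∧ y = mseG ℓ k 1) ∨ (∃ k, mseB ℓ k = v ∧ y = mseG ℓ k ℓ) ∨
      ∃ c, s(v, y) = s(.wC c, .snk) := by
  rcases (mse_adj hℓ _ _).1 h with ⟨k, m, hm, h⟩ | ⟨c, h⟩
  · rcases Sym2.eq_iff.1 h with ⟨rfl, rfl⟩ | ⟨rfl, rfl⟩
    · obtain rfl : m = 0 := by
        by_contra h0
        rw [msePos_G k m h0 hm] at hv; cases hv
      exact Or.inl ⟨k, (mseG_zero k).symm, rfl⟩
    · obtain rfl : m = ℓ := by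
        by_contra h0
        rw [msePos_G k (m + 1) (by omega) (by omega)] at hv; cases hv
      exact Or.inr (Or.inl ⟨k, (mseG_last k).symm, rfl⟩)
  · exact Or.inr (Or.inr ⟨c, h⟩)

lemma mse_path_internal {V : Type*} {G : SimpleGraph V} {s t : V} (p : G.Walk s t)
    (hp : p.IsPath) (v : V) (hv : v ∈ p.support) (hs : v ≠ s) (ht : v ≠ t) (u : V) :
    ∃ u', u' ≠ u ∧ s(v, u') ∈ p.edges := by
  suffices h : ∃ a b, a ≠ b ∧ s(v, a) ∈ p.edges ∧ s(v, b) ∈ p.edges by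
    obtain ⟨a, b, hab, ha, hb⟩ := h
    by_cases hau : a = u
    · exact ⟨b, fun h => hab (hau.trans h.symm), hb⟩
    · exact ⟨a, hau, ha⟩
  induction p with
  | nil => simp at hv; exact absurd hv hs
  | @cons a b c h q ih =>
    rw [SimpleGraph.Walk.support_cons, List.mem_cons] at hv
    have hv := hv.resolve_left hs
    rw [SimpleGraph.Walk.cons_isPath_iff] at hp
    by_cases hb : v = b
    · subst hb
      cases q with
      | nil => exact absurd rfl ht
      | @cons _ w _ h' q' =>
        refine ⟨a, w, ?_, ?_, ?_⟩
        · rintro rfl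
          apply hp.2
          simp
        · simp [Sym2.eq_swap]
        · simp
    · obtain ⟨x, y, hxy, hx, hy⟩ := ih hp.1 hv hb ht
      exact ⟨x, y, hxy, by simp [hx], by simp [hy]⟩

lemma mse_path_start {V : Type*} {G : SimpleGraph V} {s t : V} (p : G.Walk s t)
    (hp : p.IsPath) (hst : s ≠ t) :
    ∃ u, ∀ u', s(s, u') ∈ p.edges ↔ u' = u := by
  cases p with
  | nil => exact absurd rfl hst
  | @cons _ b _ h q =>
    rw [SimpleGraph.Walk.cons_isPath_iff] at hp
    refine ⟨b, fun u' => ?_⟩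
    rw [SimpleGraph.Walk.edges_cons, List.mem_cons]
    constructor
    · rintro (h1 | h1)
      · exact Sym2.congr_right.1 h1
      · exact absurd (q.fst_mem_support_of_mem_edges h1) hp.2
    · rintro rfl; exact Or.inl rfl

/-- A walk uses a chain completely. -/
def mseUsed {s t : MseSCV X C mem ℓ d} (p : (mseSCGraph X C mem ℓ d).Walk s t)
    (k : MseCh X C mem d) : Prop :=
  ∀ n ≤ ℓ, s(mseG ℓ k n, mseG ℓ k (n + 1)) ∈ p.edges

lemma mseUsed_of_edge (hℓ : 1 ≤ ℓ) (p : (mseSCGraph X C mem ℓ d).Walk .src .snk)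
    (hp : p.IsPath) (k : MseCh X C mem d) (n : ℕ) (hn : n ≤ ℓ)
    (h : s(mseG ℓ k n, mseG ℓ k (n + 1)) ∈ p.edges) : mseUsed p k := by
  have step : ∀ m < ℓ, (s(mseG ℓ k m, mseG ℓ k (m + 1)) ∈ p.edges ↔
      s(mseG ℓ k (m + 1), mseG ℓ k (m + 2)) ∈ p.edges) := by
    intro m hm
    have hpos := msePos_G (ℓ := ℓ) k (m + 1) (by omega) (by omega)
    have hs : mseG ℓ k (m + 1) ≠ .src := fun h => by rw [h] at hpos; cases hpos
    have ht : mseG ℓ k (m + 1) ≠ .snk := fun h => by rw [h] at hpos; cases hpos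
    constructor
    · intro h
      obtain ⟨u', hu, he⟩ := mse_path_internal p hp _ (p.snd_mem_support_of_mem_edges h) hs ht
        (mseG ℓ k m)
      rcases mse_adj_mid hℓ k m hm u' (p.adj_of_mem_edges he) with rfl | rfl
      · exact absurd rfl hu
      · exact he
    · intro h
      obtain ⟨u', hu, he⟩ := mse_path_internal p hp _ (p.fst_mem_support_of_mem_edges h) hs ht
        (mseG ℓ k (m + 2))
      rcases mse_adj_mid hℓ k m hm u' (p.adj_of_mem_edges he) with rfl | rfl
      · rw [Sym2.eq_swap]; exact he
      · exact absurd rfl hu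
  have all : ∀ m ≤ ℓ, (s(mseG ℓ k 0, mseG ℓ k (0 + 1)) ∈ p.edges ↔
      s(mseG ℓ k m, mseG ℓ k (m + 1)) ∈ p.edges) := by
    intro m
    induction m with
    | zero => intro _; rfl
    | succ m ih => intro hm; exact (ih (by omega)).trans (step m (by omega))
  intro m hm
  exact (all m hm).1 ((all n hn).2 h)

/-- F3: a path that uses a chain ending at an inner hub uses another edge there. -/
lemma mseUsed_other (hℓ : 1 ≤ ℓ) (p : (mseSCGraph X C mem ℓ d).Walk .src .snk)
    (hp : p.IsPath) (k : MseCh X C mem d) (hk : mseUsed p k) (v : MseSCV X C mem ℓ d)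
    (hv : mseA ℓ k = v ∨ mseB ℓ k = v) (hs : v ≠ .src) (ht : v ≠ .snk) :
    (∃ k', k' ≠ k ∧ (mseA ℓ k' = v ∨ mseB ℓ k' = v) ∧ mseUsed p k') ∨
      ∃ c, v = .wC c ∧ s(.wC c, .snk) ∈ p.edges := by
  have main : ∀ u, (u = mseG ℓ k 1 ∧ mseA ℓ k = v ∨ u = mseG ℓ k ℓ ∧ mseB ℓ k = v) →
      v ∈ p.support →
      (∃ k', k' ≠ k ∧ (mseA ℓ k' = v ∨ mseB ℓ k' = v) ∧ mseUsed p k') ∨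
      ∃ c, v = .wC c ∧ s(.wC c, .snk) ∈ p.edges := by
    intro u hu hvs
    obtain ⟨u', hne, he⟩ := mse_path_internal p hp v hvs hs ht u
    have hnone : msePos v = none := by
      rcases hv with rfl | rfl
      · exact msePos_A k
      · exact msePos_B k
    rcases mse_adj_hub hℓ v u' hnone (p.adj_of_mem_edges he) with
      ⟨k', h1, h2⟩ | ⟨k', h1, h2⟩ | ⟨c, h1⟩
    · refine Or.inl ⟨k', ?_, Or.inl h1, ?_⟩
      · rintro rfl
        rcases hu with ⟨hu, _⟩ | ⟨hu, h3⟩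
        · exact hne (h2.trans hu.symm)
        · exact mseA_ne_B k' (h1.trans h3.symm)
      · apply mseUsed_of_edge hℓ p hp k' 0 (by omega)
        rw [mseG_zero, h1, ← h2]; exact he
    · refine Or.inl ⟨k', ?_, Or.inr h1, ?_⟩
      · rintro rfl
        rcases hu with ⟨hu, h3⟩ | ⟨hu, h3⟩
        · exact mseA_ne_B k' (h3.trans h1.symm)
        · exact hne (h2.trans hu.symm)
      · apply mseUsed_of_edge hℓ p hp k' ℓ le_rfl
        rw [mseG_last, h1, ← h2, Sym2.eq_swap]; exact he
    · refine Or.inr ⟨c, ?_, h1 ▸ he⟩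
      rcases Sym2.eq_iff.1 h1 with ⟨h, -⟩ | ⟨h, -⟩
      · exact h
      · exact absurd h ht
  rcases hv with h | h
  · refine main _ (Or.inl ⟨rfl, h⟩) ?_
    have := p.fst_mem_support_of_mem_edges (hk 0 (by omega))
    rwa [mseG_zero, h] at this
  · refine main _ (Or.inr ⟨rfl, h⟩) ?_
    have := p.snd_mem_support_of_mem_edges (hk ℓ le_rfl)
    rwa [mseG_last, h] at this

lemma mseUsed_src (hℓ : 1 ≤ ℓ) (p : (mseSCGraph X C mem ℓ d).Walk .src .snk)
    (hp : p.IsPath) :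
    ∃ k, mseA ℓ k = .src ∧ mseUsed p k ∧ ∀ k', mseA ℓ k' = .src → mseUsed p k' → k' = k := by
  obtain ⟨u, hu⟩ := mse_path_start p hp (by simp)
  have he := (hu u).2 rfl
  rcases mse_adj_hub hℓ .src u rfl (p.adj_of_mem_edges he) with
      ⟨k, h1, h2⟩ | ⟨k, h1, h2⟩ | ⟨c, h1⟩
  · refine ⟨k, h1, ?_, ?_⟩
    · apply mseUsed_of_edge hℓ p hp k 0 (by omega)
      rw [mseG_zero, h1, ← h2]; exact he
    · intro k' h3 h4
      have h5 := h4 0 (by omega)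
      rw [mseG_zero, h3, hu, h2] at h5
      have h6 := msePos_G (ℓ := ℓ) k 1 (by omega) (by omega)
      rw [← h5] at h6
      exact (msePos_G' _ _ _ _ (by omega) h6).1.symm
  · cases k <;> simp [mseB] at h1
  · simp at h1

lemma mseShared_finite {V : Type*} {G : SimpleGraph V} {s t : V} {p : ℕ}
    (P : Fin p → G.Walk s t) : (mseSharedEdges P).Finite := by
  apply Set.Finite.subset (Set.finite_iUnion fun i => (P i).edges.finite_toSet)
  rintro e ⟨i, j, -, h, -⟩
  exact Set.mem_iUnion.2 ⟨i, h⟩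

lemma mseUsed_unique {p : ℕ}
    (P : Fin p → (mseSCGraph X C mem ℓ d).Walk .src .snk)
    (hP : (mseSharedEdges P).ncard ≤ ℓ) (k : MseCh X C mem d) (i j : Fin p)
    (hi : mseUsed (P i) k) (hj : mseUsed (P j) k) : i = j := by
  by_contra hij
  have h1 : (Set.range fun n : Fin (ℓ + 1) =>
      s(mseG ℓ k (n : ℕ), mseG ℓ k ((n : ℕ) + 1))) ⊆ mseSharedEdges P := by
    rintro _ ⟨n, rfl⟩
    exact ⟨i, j, hij, hi n (by omega), hj n (by omega)⟩
  have h2 := Set.ncard_le_ncard h1 (mseShared_finite P)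
  rw [← Set.image_univ, Set.ncard_image_of_injective, Set.ncard_univ, Nat.card_fin] at h2
  · omega
  · intro n m h
    apply Fin.ext
    rcases Sym2.eq_iff.1 h with ⟨h3, -⟩ | ⟨h3, h4⟩
    · exact mseG_inj k _ _ (by omega) (by omega) h3
    · have := mseG_inj k _ _ (by omega) (by omega) h3
      have := mseG_inj k _ _ (by omega) (by omega) h4
      omega

/-- Chains leaving the source. -/
def mseSC : C ⊕ (Σ x : X, {c : C // mem x c}) → MseCh X C mem d
  | .inl c => .cSW c
  | .inr q => .cSV q.1 q.2.1 q.2.2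

lemma mseSC_inj : Function.Injective (mseSC (mem := mem) (d := d)) := by
  rintro (c | ⟨x, c, h⟩) (c' | ⟨x', c', h'⟩) H
  · cases H; rfl
  · cases H
  · cases H
  · cases H; rfl

theorem mse_backward [Fintype X] [Fintype C] (hℓ : 1 ≤ ℓ)
    (hd : ∀ x, d x = Nat.card {c : C // mem x c}) (hpos : ∀ x, ∃ c, mem x c)
    {p : ℕ} (hpc : p = Nat.card (C ⊕ (Σ x : X, {c : C // mem x c})))
    (P : Fin p → (mseSCGraph X C mem ℓ d).Walk .src .snk)
    (hpath : ∀ i, (P i).IsPath) (hP : (mseSharedEdges P).ncard ≤ ℓ) :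
    ∃ S : Finset C, S.card ≤ ℓ ∧ ∀ x, ∃ c ∈ S, mem x c := by
  classical
  have F2 := mseUsed_unique P hP
  have F4 : ∀ i, ∃ q, mseUsed (P i) (mseSC q) ∧ ∀ q', mseUsed (P i) (mseSC q') → q' = q := by
    intro i
    obtain ⟨k, h1, h2, h3⟩ := mseUsed_src hℓ (P i) (hpath i)
    have : ∃ q, mseSC q = k := by
      cases k with
      | cSW c => exact ⟨.inl c, rfl⟩
      | cSV x c h => exact ⟨.inr ⟨x, c, h⟩, rfl⟩
      | _ => simp [mseA] at h1
    obtain ⟨q, rfl⟩ := this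
    refine ⟨q, h2, fun q' h4 => mseSC_inj (h3 _ ?_ h4)⟩
    rcases q' with c | q' <;> rfl
  choose φ hφ hφu using F4
  have φinj : Function.Injective φ := by
    intro i j h
    refine F2 _ i j (hφ i) ?_
    rw [h]; exact hφ j
  have φbij : Function.Bijective φ := by
    rw [Nat.bijective_iff_injective_and_card]
    exact ⟨φinj, by rw [Nat.card_fin, hpc]⟩
  choose π hπ using φbij.2
  have hπU : ∀ q, mseUsed (P (π q)) (mseSC q) := fun q => by
    have := hφ (π q); rwa [hπ] at this
  have πinj : Function.Injective π := fun q q' h => by rw [← hπ q, h, hπ]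
  have hπu : ∀ q q', mseUsed (P (π q)) (mseSC q') → q' = q := fun q q' h => by
    rw [hφu _ _ h, hπ]
  -- the paths through `v_x`
  have step1 : ∀ x (c : {c : C // mem x c}), ∃ c' : {c : C // mem x c},
      mseUsed (P (π (.inr ⟨x, c⟩))) (.cV x c'.1 c'.2) := by
    intro x c
    rcases mseUsed_other hℓ _ (hpath _) _ (hπU (.inr ⟨x, c⟩)) (.vx x) (Or.inr rfl)
      (by simp) (by simp) with ⟨k', hne, hk, hu⟩ | ⟨c, h, -⟩
    · cases k' with
      | cV y c' h =>
        simp [mseA, mseB] at hk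
        subst hk
        exact ⟨⟨c', h⟩, hu⟩
      | cSV y c' h =>
        exfalso
        have := hπu _ (.inr ⟨y, c', h⟩) hu
        exact hne (congrArg mseSC this)
      | _ => simp [mseA, mseB] at hk
    · cases h
  choose σ hσ using step1
  have σinj : ∀ x, Function.Injective (σ x) := by
    intro x c c' h
    have h1 := hσ x c
    rw [h] at h1
    have := πinj (F2 _ _ _ h1 (hσ x c'))
    simpa using this
  have σsurj : ∀ x, Function.Surjective (σ x) := fun x => Finite.surjective_of_injective (σinj x)
  choose τ hτ using σsurj
  set f : (Σ x : X, {c : C // mem x c}) → Fin p := fun q => π (.inr ⟨q.1, τ q.1 q.2⟩) with hf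
  have finj : ∀ q q', f q = f q' → q = q' := by
    rintro ⟨x, c⟩ ⟨x', c'⟩ h
    have h := πinj h
    simp only [Sum.inr.injEq, Sigma.mk.injEq] at h
    obtain ⟨rfl, h⟩ := h
    have h := eq_of_heq h
    have := congrArg (σ x) h
    rw [hτ, hτ] at this
    rw [this]
  have fV : ∀ x c h, mseUsed (P (f ⟨x, c, h⟩)) (.cV x c h) := by
    intro x c h
    have := hσ x (τ x ⟨c, h⟩)
    rw [hτ] at this
    exact this
  have fS : ∀ q c, ¬ mseUsed (P (f q)) (.cSW c) := by
    intro q c h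
    have := hπu _ (.inl c) h
    cases this
  -- uses at `v_{x,C}`
  have vother : ∀ i x c h k, mseUsed (P i) k → mseA ℓ k = .vxc x c h →
      ∃ k', k' ≠ k ∧ mseUsed (P i) k' ∧ (k' = .cV x c h ∨ k' = .cT x c h ∨ k' = .cW x c h) := by
    intro i x c h k hk hA
    rcases mseUsed_other hℓ _ (hpath _) _ hk _ (Or.inl hA)
      (by simp) (by simp) with ⟨k', hne, hk', hu⟩ | ⟨c, h, -⟩
    · refine ⟨k', hne, hu, ?_⟩
      cases k' <;> simp [mseA, mseB] at hk' <;> obtain ⟨rfl, rfl⟩ := hk' <;> simp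
    · cases h
  have fTW : ∀ x c h, mseUsed (P (f ⟨x, c, h⟩)) (.cT x c h) ∨
      mseUsed (P (f ⟨x, c, h⟩)) (.cW x c h) := by
    intro x c h
    obtain ⟨k', hne, hu, rfl | rfl | rfl⟩ := vother _ x c h _ (fV x c h) rfl
    · exact absurd rfl hne
    · exact Or.inl hu
    · exact Or.inr hu
  have H : ∀ i x c h k, mseUsed (P i) k → (k = .cT x c h ∨ k = .cW x c h) →
      i = f ⟨x, c, h⟩ := by
    intro i x c h k hk hkk
    by_contra hne
    have nV : ¬ mseUsed (P i) (.cV x c h) := fun h' => hne (F2 _ _ _ h' (fV x c h))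
    have both : mseUsed (P i) (.cT x c h) ∧ mseUsed (P i) (.cW x c h) := by
      rcases hkk with rfl | rfl
      · obtain ⟨k', hne, hu, rfl | rfl | rfl⟩ := vother _ x c h _ hk rfl
        · exact absurd hu nV
        · exact absurd rfl hne
        · exact ⟨hk, hu⟩
      · obtain ⟨k', hne, hu, rfl | rfl | rfl⟩ := vother _ x c h _ hk rfl
        · exact absurd hu nV
        · exact ⟨hu, hk⟩
        · exact absurd rfl hne
    rcases fTW x c h with h' | h'
    · exact hne (F2 _ _ _ both.1 h')
    · exact hne (F2 _ _ _ both.2 h')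
  have exW : ∀ x, ∃ c h, mseUsed (P (f ⟨x, c, h⟩)) (.cW x c h) := by
    intro x
    by_contra hno
    push Not at hno
    have toT : ∀ c : {c : C // mem x c}, ∃ j : Fin (d x - 1),
        mseUsed (P (f ⟨x, c⟩)) (.cTT x j) := by
      rintro ⟨c, h⟩
      have hT := (fTW x c h).resolve_right (hno c h)
      rcases mseUsed_other hℓ _ (hpath _) _ hT (.tx x) (Or.inr rfl)
        (by simp) (by simp) with ⟨k', hne, hk', hu⟩ | ⟨c, h, -⟩
      · cases k' with
        | cT y c' h' =>
          exfalso
          have := finj _ _ (H _ _ _ _ _ hu (Or.inl rfl))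
          cases this
          exact hne rfl
        | cTT y j =>
          simp [mseA, mseB] at hk'
          subst hk'
          exact ⟨j, hu⟩
        | _ => simp [mseA, mseB] at hk'
      · cases h
    choose J hJ using toT
    have Jinj : Function.Injective J := by
      intro c c' h
      have h1 := hJ c
      rw [h] at h1
      have := finj _ _ (F2 _ _ _ h1 (hJ c'))
      simpa using this
    have h1 := Nat.card_le_card_of_injective J Jinj
    rw [Nat.card_fin, ← hd] at h1
    have : 0 < d x := by
      rw [hd]
      obtain ⟨c, hc⟩ := hpos x
      have : Nonempty {c : C // mem x c} := ⟨⟨c, hc⟩⟩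
      exact Nat.card_pos
    omega
  have final : ∀ x, ∃ c, mem x c ∧ s(MseSCV.wC c, MseSCV.snk) ∈ mseSharedEdges P := by
    intro x
    obtain ⟨c, h, hW⟩ := exW x
    refine ⟨c, h, f ⟨x, c, h⟩, π (.inl c), ?_, ?_, ?_⟩
    · intro h'
      cases πinj h'
    · rcases mseUsed_other hℓ _ (hpath _) _ hW (.wC c) (Or.inr rfl)
        (by simp) (by simp) with ⟨k', hne, hk', hu⟩ | ⟨c', h', he⟩
      · exfalso
        cases k' with
        | cW y c' h' =>
          simp [mseA, mseB] at hk'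
          subst hk'
          have := finj _ _ (H _ _ _ _ _ hu (Or.inr rfl))
          cases this
          exact hne rfl
        | cSW c' => exact fS _ _ hu
        | _ => simp [mseA, mseB] at hk'
      · cases h'; exact he
    · rcases mseUsed_other hℓ _ (hpath _) _ (hπU (.inl c)) (.wC c) (Or.inr rfl)
        (by simp) (by simp) with ⟨k', hne, hk', hu⟩ | ⟨c', h', he⟩
      · exfalso
        cases k' with
        | cW y c' h' =>
          have := πinj (H _ _ _ _ _ hu (Or.inr rfl))
          cases this
        | cSW c' =>
          simp [mseA, mseB] at hk'
          subst hk'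
          exact hne rfl
        | _ => simp [mseA, mseB] at hk'
      · cases h'; exact he
  refine ⟨Finset.univ.filter fun c => s(MseSCV.wC c, MseSCV.snk) ∈ mseSharedEdges P, ?_, ?_⟩
  · refine le_trans ?_ hP
    rw [← Set.ncard_coe_finset]
    refine Set.ncard_le_ncard_of_injOn (fun c => s(MseSCV.wC c, MseSCV.snk)) ?_ ?_
      (mseShared_finite P)
    · intro c hc
      simpa using hc
    · intro c _ c' _ h
      simpa using h
  · intro x
    obtain ⟨c, hc, he⟩ := final x
    exact ⟨c, by simpa using he, hc⟩

/-! ### The forward direction -/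

/-- Edges of a chain. -/
def mseE (ℓ : ℕ) (k : MseCh X C mem d) : Set (Sym2 (MseSCV X C mem ℓ d)) :=
  {e | ∃ n ≤ ℓ, e = s(mseG ℓ k n, mseG ℓ k (n + 1))}

lemma mseE_disj (hℓ : 1 ≤ ℓ) (k k' : MseCh X C mem d) (e) (h : e ∈ mseE ℓ k)
    (h' : e ∈ mseE ℓ k') : k = k' := by
  obtain ⟨n, hn, rfl⟩ := h
  obtain ⟨m, hm, h⟩ := h'
  have hcase : ∃ r, r ≤ ℓ + 1 ∧ r ≠ 0 ∧ r ≤ ℓ ∧ mseG ℓ k r ∈ s(mseG ℓ k n, mseG ℓ k (n + 1)) := by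
    by_cases h0 : n = 0
    · exact ⟨n + 1, by omega, by omega, by omega, by simp⟩
    · exact ⟨n, by omega, by omega, by omega, by simp⟩
  obtain ⟨r, -, hr0, hr, hmem⟩ := hcase
  have hp := msePos_G (ℓ := ℓ) k r hr0 hr
  rw [h, Sym2.mem_iff] at hmem
  rcases hmem with h1 | h1 <;> rw [h1] at hp <;>
    exact (msePos_G' _ _ _ _ (by omega) hp).1

lemma mseE_not_w (hℓ : 1 ≤ ℓ) (k : MseCh X C mem d) (c : C) :
    s(MseSCV.wC c, MseSCV.snk) ∉ mseE ℓ k := by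
  rintro ⟨n, hn, h⟩
  have hcase : ∃ r, r ≠ 0 ∧ r ≤ ℓ ∧ mseG ℓ k r ∈ s(mseG ℓ k n, mseG ℓ k (n + 1)) := by
    by_cases h0 : n = 0
    · exact ⟨n + 1, by omega, by omega, by simp⟩
    · exact ⟨n, by omega, by omega, by simp⟩
  obtain ⟨r, hr0, hr, hmem⟩ := hcase
  have hp := msePos_G (ℓ := ℓ) k r hr0 hr
  rw [← h, Sym2.mem_iff] at hmem
  rcases hmem with h1 | h1 <;> rw [h1] at hp <;> cases hp

/-- There is a walk from `a` to `b` using edges of `E` only. -/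
def mseConn (E : Set (Sym2 (MseSCV X C mem ℓ d))) (a b : MseSCV X C mem ℓ d) : Prop :=
  ∃ p : (mseSCGraph X C mem ℓ d).Walk a b, ∀ e ∈ p.edges, e ∈ E

lemma mseConn.trans {E : Set (Sym2 (MseSCV X C mem ℓ d))} {a b c : MseSCV X C mem ℓ d}
    (h : mseConn E a b) (h' : mseConn E b c) : mseConn E a c := by
  obtain ⟨p, hp⟩ := h
  obtain ⟨q, hq⟩ := h'
  refine ⟨p.append q, fun e he => ?_⟩
  rw [SimpleGraph.Walk.edges_append, List.mem_append] at he
  exact he.elim (hp e) (hq e)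

lemma mseConn.symm {E : Set (Sym2 (MseSCV X C mem ℓ d))} {a b : MseSCV X C mem ℓ d}
    (h : mseConn E a b) : mseConn E b a := by
  obtain ⟨p, hp⟩ := h
  refine ⟨p.reverse, fun e he => ?_⟩
  rw [SimpleGraph.Walk.edges_reverse, List.mem_reverse] at he
  exact hp e he

lemma mseConn_edge {E : Set (Sym2 (MseSCV X C mem ℓ d))} {a b : MseSCV X C mem ℓ d}
    (h : (mseSCGraph X C mem ℓ d).Adj a b) (hE : s(a, b) ∈ E) : mseConn E a b := by
  refine ⟨.cons h .nil, fun e he => ?_⟩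
  simp at he
  rw [he]; exact hE

lemma mseConn_chain (hℓ : 1 ≤ ℓ) {E : Set (Sym2 (MseSCV X C mem ℓ d))} (k : MseCh X C mem d)
    (hE : mseE ℓ k ⊆ E) : mseConn E (mseA ℓ k) (mseB ℓ k) := by
  have : ∀ n ≤ ℓ + 1, mseConn E (mseG ℓ k 0) (mseG ℓ k n) := by
    intro n
    induction n with
    | zero => intro _; exact ⟨.nil, by simp⟩
    | succ n ih =>
      intro hn
      refine (ih (by omega)).trans (mseConn_edge ?_ (hE ⟨n, by omega, rfl⟩))
      exact (mse_adj hℓ _ _).2 (Or.inl ⟨k, n, by omega, rfl⟩)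
  have := this (ℓ + 1) le_rfl
  rwa [mseG_zero, mseG_last] at this

theorem mse_forward [Fintype X] [Fintype C] (hℓ : 1 ≤ ℓ)
    (hd : ∀ x, d x = Nat.card {c : C // mem x c})
    {p : ℕ} (hpc : p = Nat.card (C ⊕ (Σ x : X, {c : C // mem x c})))
    (S : Finset C) (hS : S.card ≤ ℓ) (hcov : ∀ x, ∃ c ∈ S, mem x c) :
    ∃ P : Fin p → (mseSCGraph X C mem ℓ d).Walk .src .snk,
      (∀ i, (P i).IsPath) ∧ (mseSharedEdges P).ncard ≤ ℓ := by
  classical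
  choose γ hγS hγ using hcov
  have hJ : ∀ x, ∃ J : {c : {c : C // mem x c} // c ≠ ⟨γ x, hγ x⟩} → Fin (d x - 1),
      Function.Injective J := by
    intro x
    have hcard : Fintype.card {c : {c : C // mem x c} // c ≠ ⟨γ x, hγ x⟩} = d x - 1 := by
      rw [hd, Nat.card_eq_fintype_card]
      simp [Fintype.card_subtype_compl]
    exact ⟨Fintype.equivFinOfCardEq hcard, (Fintype.equivFinOfCardEq hcard).injective⟩
  choose J hJ using hJ
  -- allowed chains and final edges
  let K : C ⊕ (Σ x : X, {c : C // mem x c}) → MseCh X C mem d → Prop := fun q k =>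
    match q with
    | .inl c => k = .cSW c
    | .inr ⟨x, c⟩ => k = .cSV x c.1 c.2 ∨ k = .cV x c.1 c.2 ∨
        (c = ⟨γ x, hγ x⟩ ∧ k = .cW x c.1 c.2) ∨
        (k = .cT x c.1 c.2) ∨ ∃ h : c ≠ ⟨γ x, hγ x⟩, k = .cTT x (J x ⟨c, h⟩)
  let L : C ⊕ (Σ x : X, {c : C // mem x c}) → C → Prop := fun q c' =>
    match q with
    | .inl c => c' = c
    | .inr ⟨x, c⟩ => c = ⟨γ x, hγ x⟩ ∧ c' = c.1
  have Kdisj : ∀ q q' k, K q k → K q' k → q = q' := by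
    rintro (c | ⟨x, c, h⟩) (c' | ⟨x', c', h'⟩) k h1 h2
    · simp only [K] at h1 h2
      rw [h1] at h2; cases h2; rfl
    · simp only [K] at h1 h2
      subst h1
      simp at h2
    · simp only [K] at h1 h2
      subst h2
      simp at h1
    · simp only [K] at h1 h2
      rcases h1 with rfl | rfl | ⟨-, rfl⟩ | rfl | ⟨hn, rfl⟩
      · simp at h2; obtain ⟨rfl, rfl⟩ := h2; rfl
      · simp at h2; obtain ⟨rfl, rfl⟩ := h2; rfl
      · simp at h2; obtain ⟨-, rfl, rfl⟩ := h2; rfl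
      · simp at h2; obtain ⟨rfl, rfl⟩ := h2; rfl
      · rcases h2 with h2 | h2 | ⟨-, h2⟩ | h2 | ⟨hn', h2⟩
        · cases h2
        · cases h2
        · cases h2
        · cases h2
        · simp only [MseCh.cTT.injEq] at h2
          obtain ⟨rfl, h2⟩ := h2
          have := hJ x (eq_of_heq h2)
          simp at this
          subst this
          rfl
  let E : C ⊕ (Σ x : X, {c : C // mem x c}) → Set (Sym2 (MseSCV X C mem ℓ d)) := fun q =>
    {e | (∃ k, K q k ∧ e ∈ mseE ℓ k) ∨ ∃ c, L q c ∧ e = s(.wC c, .snk)}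
  have hKE : ∀ q k, K q k → mseE ℓ k ⊆ E q := fun q k h e he => Or.inl ⟨k, h, he⟩
  have hLE : ∀ q c, L q c → mseConn (E q) (.wC c) .snk := fun q c h =>
    mseConn_edge ((mse_adj hℓ _ _).2 (Or.inr ⟨c, rfl⟩)) (Or.inr ⟨c, h, rfl⟩)
  have conn : ∀ q, mseConn (E q) .src .snk := by
    rintro (c | ⟨x, c, h⟩)
    · have h1 := mseConn_chain hℓ (E := E (.inl c)) (.cSW c) (hKE (.inl c) (.cSW c) rfl)
      exact h1.trans (hLE (.inl c) c rfl)
    · have h1 := mseConn_chain hℓ (E := E (.inr ⟨x, c, h⟩)) (.cSV x c h) (hKE (.inr ⟨x, c, h⟩) (.cSV x c h) (Or.inl rfl))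
      have h2 := mseConn_chain hℓ (E := E (.inr ⟨x, c, h⟩)) (.cV x c h)
        (hKE (.inr ⟨x, c, h⟩) (.cV x c h) (Or.inr (Or.inl rfl)))
      refine (h1.trans h2.symm).trans ?_
      by_cases hc : (⟨c, h⟩ : {c : C // mem x c}) = ⟨γ x, hγ x⟩
      · have h3 := mseConn_chain hℓ (E := E (.inr ⟨x, c, h⟩)) (.cW x c h)
          (hKE (.inr ⟨x, c, h⟩) (.cW x c h) (Or.inr (Or.inr (Or.inl ⟨hc, rfl⟩))))
        exact h3.trans (hLE (.inr ⟨x, c, h⟩) c ⟨hc, rfl⟩)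
      · have h3 := mseConn_chain hℓ (E := E (.inr ⟨x, c, h⟩)) (.cT x c h)
          (hKE (.inr ⟨x, c, h⟩) (.cT x c h) (Or.inr (Or.inr (Or.inr (Or.inl rfl)))))
        have h4 := mseConn_chain hℓ (E := E (.inr ⟨x, c, h⟩)) (.cTT x (J x ⟨⟨c, h⟩, hc⟩))
          (hKE (.inr ⟨x, c, h⟩) (.cTT x (J x ⟨⟨c, h⟩, hc⟩)) (Or.inr (Or.inr (Or.inr (Or.inr ⟨hc, rfl⟩)))))
        exact h3.trans h4
  choose W hW using conn
  have hcard : Fintype.card (C ⊕ (Σ x : X, {c : C // mem x c})) = p := by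
    rw [hpc, Nat.card_eq_fintype_card]
  let eqv := (Fintype.equivFinOfCardEq hcard).symm
  refine ⟨fun i => (W (eqv i)).bypass, fun i => SimpleGraph.Walk.bypass_isPath _, ?_⟩
  have hsub : mseSharedEdges (fun i => (W (eqv i)).bypass) ⊆
      ((S.image fun c => s(MseSCV.wC c, MseSCV.snk) : Finset (Sym2 (MseSCV X C mem ℓ d))) :
        Set (Sym2 (MseSCV X C mem ℓ d))) := by
    rintro e ⟨i, j, hij, hi, hj⟩
    have hi := hW _ _ (SimpleGraph.Walk.edges_bypass_subset_edges _ hi)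
    have hj := hW _ _ (SimpleGraph.Walk.edges_bypass_subset_edges _ hj)
    have hne : eqv i ≠ eqv j := fun h => hij (eqv.injective h)
    generalize eqv i = q at hi hne
    generalize eqv j = q' at hj hne
    rcases hi with ⟨k, hk, he⟩ | ⟨c, hc, rfl⟩
    · exfalso
      rcases hj with ⟨k', hk', he'⟩ | ⟨c, hc, rfl⟩
      · obtain rfl := mseE_disj hℓ k k' e he he'
        exact hne (Kdisj _ _ _ hk hk')
      · exact mseE_not_w hℓ k c he
    · rcases hj with ⟨k', hk', he'⟩ | ⟨c', hc', he⟩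
      · exact absurd he' (mseE_not_w hℓ k' c)
      · have : c = c' := by simpa using he
        subst this
        have hcS : c ∈ S := by
          rcases q with a | ⟨x, a, h⟩
          · rcases q' with b | ⟨x, b, h⟩
            · simp only [L] at hc hc'
              subst hc
              subst hc'
              exact absurd rfl hne
            · obtain ⟨h1, rfl⟩ := hc'
              cases h1
              exact hγS x
          · obtain ⟨h1, rfl⟩ := hc
            cases h1
            exact hγS x
        simp only [Finset.coe_image, Set.mem_image]
        exact ⟨c, hcS, rfl⟩
  refine (Set.ncard_le_ncard hsub (Finset.finite_toSet _)).trans ?_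
  rw [Set.ncard_coe_finset]
  exact Finset.card_image_le.trans hS

end MseAux

theorem stmt_0 {X : Type} [Fintype X] [DecidableEq X]
    (𝒞 : Finset (Finset X)) (hcov : ∀ x : X, ∃ C ∈ 𝒞, x ∈ C)
    (ℓ : ℕ) (hℓ : 1 ≤ ℓ) :
    (∃ 𝒞' : Finset (Finset X), 𝒞' ⊆ 𝒞 ∧ 𝒞'.card ≤ ℓ ∧ ∀ x : X, ∃ C ∈ 𝒞', x ∈ C) ↔
    (∃ P : Fin (𝒞.card + ∑ x : X, (𝒞.filter fun C => x ∈ C).card) →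
        (mseSCGraph X {C : Finset X // C ∈ 𝒞} (fun x c => x ∈ c.1) ℓ
          (fun x => (𝒞.filter fun C => x ∈ C).card)).Walk MseSCV.src MseSCV.snk,
      (∀ i, (P i).IsPath) ∧ (mseSharedEdges P).ncard ≤ ℓ) := by
  classical
  have hd : ∀ x : X, (𝒞.filter fun C => x ∈ C).card =
      Nat.card {c : {C : Finset X // C ∈ 𝒞} // x ∈ c.1} := by
    intro x
    rw [Nat.card_congr (Equiv.subtypeSubtypeEquivSubtypeInter (fun C => C ∈ 𝒞) (fun C => x ∈ C)),
      Nat.card_eq_fintype_card, Fintype.card_subtype]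
    congr 1
    ext C
    simp
  have hpc : 𝒞.card + ∑ x : X, (𝒞.filter fun C => x ∈ C).card =
      Nat.card ({C : Finset X // C ∈ 𝒞} ⊕
        (Σ x : X, {c : {C : Finset X // C ∈ 𝒞} // x ∈ c.1})) := by
    rw [Nat.card_sum, Nat.card_sigma]
    simp only [hd]
    simp
  constructor
  · rintro ⟨𝒞', hsub, hcard, hcov'⟩
    refine mse_forward hℓ hd hpc (𝒞'.subtype fun C => C ∈ 𝒞) ?_ ?_
    · rw [Finset.card_subtype]
      exact (Finset.card_filter_le _ _).trans hcard
    · intro x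
      obtain ⟨C, hC, hx⟩ := hcov' x
      exact ⟨⟨C, hsub hC⟩, by simpa using hC, hx⟩
  · rintro ⟨P, hpath, hP⟩
    obtain ⟨S, hS, hc⟩ := mse_backward hℓ hd
      (fun x => by obtain ⟨C, hC, hx⟩ := hcov x; exact ⟨⟨C, hC⟩, hx⟩) hpc P hpath hP
    refine ⟨S.map (Function.Embedding.subtype _), ?_, ?_, ?_⟩
    · intro C hC
      simp only [Finset.mem_map, Function.Embedding.coe_subtype] at hC
      obtain ⟨c, -, rfl⟩ := hC
      exact c.2
    · rw [Finset.card_map]; exact hS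
    · intro x
      obtain ⟨c, hcS, hx⟩ := hc x
      exact ⟨c.1, Finset.mem_map_of_mem _ hcS, hx⟩
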